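/- Let D ⊆ ℂ be compact and T₁,…,T_m : D → D be contractions that extend to conformal (injective holomorphic) self-maps of a domain B containing D. Suppose the limit set X of the iterated function scheme T = {T₁,…,T_m} satisfies dim X > s. Then for all sufficiently large p ∈ ℕ, the iterated function scheme T^p = { T_{i_p}∘…∘T_{i_1} : i₁,…,i_p ∈ {1,…,m} } satisfies: for each multi-index i there is a constant b_i ∈ (0,1) with |S_i(z) − S_i(w)| ≥ b_i|z − w| for all z,w ∈ D (where S_i = T_{i_p}∘…∘T_{i_1}), and Σ_i b_i^s > 1. -/

import Mathlib

open MeasureTheory Set Metric Filter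

/-- `compWord T p w` is the composition `T_{w(p-1)} ∘ … ∘ T_{w 0}`. -/
def compWord {m : ℕ} (T : Fin m → ℂ → ℂ) : (p : ℕ) → (Fin p → Fin m) → ℂ → ℂ
  | 0, _ => id
  | p + 1, w => T (w (Fin.last p)) ∘ compWord T p (fun j => w j.castSucc)

/-- A nonvanishing holomorphic function on a disc has a holomorphic logarithm. -/
lemma exists_log_on_ball {f : ℂ → ℂ} {c : ℂ} {R : ℝ} (hf : DifferentiableOn ℂ f (ball c R))
    (h0 : ∀ z ∈ ball c R, f z ≠ 0) :
    ∃ L : ℂ → ℂ, (∀ z ∈ ball c R, HasDerivAt L (deriv f z / f z) z) ∧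
      ∀ z ∈ ball c R, Complex.exp (L z) = f z := by
  rcases le_or_gt R 0 with hR | hR
  · exact ⟨0, by simp [ball_eq_empty.2 hR], by simp [ball_eq_empty.2 hR]⟩
  have hc : c ∈ ball c R := mem_ball_self hR
  obtain ⟨L, hLc, hL⟩ := (((hf.deriv isOpen_ball).div hf h0).isExactOn_ball).with_val_at c
    (Complex.log (f c))
  refine ⟨L, hL, fun z hz => ?_⟩
  have hd : ∀ w ∈ ball c R, HasDerivAt (fun w => f w * Complex.exp (-L w)) 0 w := by
    intro w hw
    have h1 := (hf.differentiableAt (isOpen_ball.mem_nhds hw)).hasDerivAt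
    have h2 := (h1.mul (hL w hw).neg.cexp)
    refine h2.congr_deriv ?_
    have := h0 w hw
    simp only [Pi.div_apply, Pi.neg_apply]
    field_simp
    ring
  have := isOpen_ball.is_const_of_deriv_eq_zero (convex_ball c R).isPreconnected
    (fun w hw => (hd w hw).differentiableAt.differentiableWithinAt)
    (fun w hw => (hd w hw).deriv) hz hc
  simp only [hLc, Complex.exp_neg, Complex.exp_log (h0 c hc)] at this
  rw [mul_inv_cancel₀ (h0 c hc)] at this
  have he := Complex.exp_ne_zero (L z)
  field_simp at this
  exact this.symm

/-- A weak form of Bloch's theorem: if the image of a disc under a holomorphic function contains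
no closed disc of radius `M`, then the derivative at the centre is controlled by `M`. -/
lemma norm_deriv_mul_le_of_not_closedBall_subset_image {g : ℂ → ℂ} {c : ℂ} {R M : ℝ} (hR : 0 < R)
    (hM : 0 ≤ M) (hg : DifferentiableOn ℂ g (ball c R))
    (h : ∀ q, ¬ closedBall q M ⊆ g '' ball c R) : ‖deriv g c‖ * R ≤ 100 * M := by
  rcases eq_or_ne (deriv g c) 0 with h0 | h0
  · rw [h0]; simpa using hM
  have hg' : DifferentiableOn ℂ (deriv g) (ball c R) := hg.deriv isOpen_ball
  have hsub : closedBall c (R / 2) ⊆ ball c R := closedBall_subset_ball (by linarith)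
  have hcont : ContinuousOn (fun z => ‖deriv g z‖ * (R / 2 - dist z c)) (closedBall c (R / 2)) :=
    ((hg'.continuousOn.mono hsub).norm).mul (by fun_prop)
  obtain ⟨a, ha, hmax⟩ := (isCompact_closedBall c (R / 2)).exists_isMaxOn
    ⟨c, mem_closedBall_self (by linarith)⟩ hcont
  have hmax' : ∀ z ∈ closedBall c (R / 2), ‖deriv g z‖ * (R / 2 - dist z c) ≤
    ‖deriv g a‖ * (R / 2 - dist a c) := fun z hz => hmax hz
  have hc := hmax' c (mem_closedBall_self (by linarith))
  rw [dist_self, sub_zero] at hc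
  have hpos : 0 < ‖deriv g c‖ * (R / 2) := mul_pos (norm_pos_iff.2 h0) (by linarith)
  obtain ⟨t, ht⟩ : ∃ t, t = (R / 2 - dist a c) / 2 := ⟨_, rfl⟩
  have hac : R / 2 - dist a c = 2 * t := by linarith
  rw [hac] at hc hmax'
  have htA : 0 < ‖deriv g a‖ * (2 * t) := hpos.trans_le hc
  have htpos : 0 < t := by
    have : 0 ≤ 2 * t := by rw [← hac]; exact sub_nonneg.2 ha
    rcases this.lt_or_eq with h | h
    · linarith
    · rw [← h] at htA; simp at htA
  obtain ⟨A, hA⟩ : ∃ A, A = ‖deriv g a‖ := ⟨_, rfl⟩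
  rw [← hA] at hc hmax' htA
  have hApos : 0 < A := by
    have : 0 ≤ A := hA ▸ norm_nonneg _
    rcases this.lt_or_eq with h | h
    · exact h
    · rw [← h] at htA; simp at htA
  have hin : closedBall a t ⊆ closedBall c (R / 2) := by
    refine closedBall_subset_closedBall' ?_
    linarith
  have hbd : ∀ z ∈ closedBall a t, ‖deriv g z‖ ≤ 2 * A := by
    intro z hz
    have h1 := hmax' z (hin hz)
    have h2 : t ≤ R / 2 - dist z c := by
      have := dist_triangle z a c
      have := mem_closedBall.1 hz
      linarith
    have h3 : ‖deriv g z‖ * t ≤ 2 * A * t := by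
      nlinarith [mul_le_mul_of_nonneg_left h2 (norm_nonneg (deriv g z))]
    exact le_of_mul_le_mul_right h3 htpos
  have hbR : closedBall a t ⊆ ball c R := hin.trans hsub
  have hvar : ∀ z ∈ closedBall a (t / 6), ‖deriv g z - deriv g a‖ ≤ A / 2 := by
    intro z hz
    have hz' : z ∈ ball a t := closedBall_subset_ball (by linarith) hz
    have := Complex.dist_le_div_mul_dist_of_mapsTo_ball (R₂ := 3 * A)
      (hg'.mono (ball_subset_closedBall.trans hbR)) (fun w hw => by
        rw [mem_closedBall, dist_eq_norm]
        have := hbd w (ball_subset_closedBall hw)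
        have := norm_sub_le (deriv g w) (deriv g a)
        linarith) hz'
    rw [dist_eq_norm] at this
    refine this.trans ?_
    have hz2 := mem_closedBall.1 hz
    calc 3 * A / t * dist z a ≤ 3 * A / t * (t / 6) := by gcongr
      _ = A / 2 := by field_simp; norm_num
  have hlin : ∀ z ∈ sphere a (t / 6), A * t / 12 ≤ ‖g z - g a‖ := by
    intro z hz
    have hz' : z ∈ closedBall a (t / 6) := sphere_subset_closedBall hz
    have hd : ∀ w ∈ closedBall a (t / 6), HasDerivWithinAt (fun w => g w - deriv g a * w)
        (deriv g w - deriv g a) (closedBall a (t / 6)) w := by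
      intro w hw
      have hw' : w ∈ ball c R := hbR (closedBall_subset_closedBall (by linarith) hw)
      have h1 := (hg.differentiableAt (isOpen_ball.mem_nhds hw')).hasDerivAt
      have h2 := (hasDerivAt_id w).const_mul (deriv g a)
      simpa using (h1.fun_sub h2).hasDerivWithinAt
    have := (convex_closedBall a (t / 6)).norm_image_sub_le_of_norm_hasDerivWithin_le hd hvar
      (mem_closedBall_self (by linarith)) hz'
    have hza : ‖z - a‖ = t / 6 := by rw [← dist_eq_norm]; exact hz
    rw [hza] at this
    have e : deriv g a * (z - a) = (g z - g a) -
      ((fun w => g w - deriv g a * w) z - (fun w => g w - deriv g a * w) a) := by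
      simp only; ring
    have h4 := norm_sub_le (g z - g a)
      ((fun w => g w - deriv g a * w) z - (fun w => g w - deriv g a * w) a)
    rw [← e, norm_mul, hza, ← hA] at h4
    linarith
  have hfreq : ∃ᶠ z in nhds a, g z ≠ g a := by
    have hda : HasDerivAt g (deriv g a) a := (hg.differentiableAt
      (isOpen_ball.mem_nhds (hbR (mem_closedBall_self htpos.le)))).hasDerivAt
    have := hda.eventually_ne (c := g a) (norm_pos_iff.1 (hA ▸ hApos))
    exact this.frequently.filter_mono nhdsWithin_le_nhds
  have hdc : DiffContOnCl ℂ g (ball a (t / 6)) := by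
    refine DifferentiableOn.diffContOnCl (hg.mono ?_)
    exact closure_ball_subset_closedBall.trans
      ((closedBall_subset_closedBall (by linarith)).trans hbR)
  have himg := hdc.ball_subset_image_closedBall (by linarith) hlin hfreq
  have hle : A * t / 12 / 2 ≤ M := by
    by_contra! hlt
    refine h (g a) ((closedBall_subset_ball hlt).trans (himg.trans (image_mono ?_)))
    exact (closedBall_subset_closedBall (by linarith)).trans hbR
  nlinarith

/-- The logarithmic derivative of a nonvanishing univalent function on a disc is bounded in terms
of the radius of the disc. -/
lemma norm_deriv_mul_le_of_injOn_of_ne_zero {f : ℂ → ℂ} {c : ℂ} {R : ℝ} (hR : 0 < R)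
    (hf : DifferentiableOn ℂ f (ball c R)) (hinj : InjOn f (ball c R))
    (h0 : ∀ z ∈ ball c R, f z ≠ 0) : ‖deriv f c / f c‖ * R ≤ 400 := by
  obtain ⟨L, hL, hexp⟩ := exists_log_on_ball hf h0
  have hno : ∀ q, ¬ closedBall q Real.pi ⊆ L '' ball c R := by
    intro q hq
    obtain ⟨x, hx, hxq⟩ := hq (show q + Real.pi * Complex.I ∈ _ by
      rw [mem_closedBall, dist_eq_norm]; simp [abs_of_pos Real.pi_pos])
    obtain ⟨y, hy, hyq⟩ := hq (show q - Real.pi * Complex.I ∈ _ by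
      rw [mem_closedBall, dist_eq_norm]; simp [abs_of_pos Real.pi_pos])
    have hxy : x = y := by
      refine hinj hx hy ?_
      rw [← hexp x hx, ← hexp y hy, hxq, hyq, Complex.exp_add, Complex.exp_sub]
      simp [div_neg]
    rw [← hxy, hxq] at hyq
    have h1 : (Real.pi : ℂ) * Complex.I = 0 := by linear_combination hyq / 2
    simp [Real.pi_ne_zero] at h1
  have := norm_deriv_mul_le_of_not_closedBall_subset_image hR Real.pi_pos.le
    (fun z hz => (hL z hz).differentiableAt.differentiableWithinAt) hno
  rw [(hL c (mem_ball_self hR)).deriv] at this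
  linarith [Real.pi_le_four]

/-- The derivative of an injective holomorphic function does not vanish. -/
lemma deriv_ne_zero_of_injOn {f : ℂ → ℂ} {B : Set ℂ} (hB : IsOpen B)
    (hf : DifferentiableOn ℂ f B) (hinj : InjOn f B) {v : ℂ} (hv : v ∈ B) : deriv f v ≠ 0 := by
  have han : AnalyticAt ℂ (fun z => f z - f v) v :=
    (hf.analyticAt (hB.mem_nhds hv)).sub analyticAt_const
  have hne : ¬ ∀ᶠ z in nhds v, f z - f v = 0 := by
    intro h
    have h2 := (h.and (hB.mem_nhds hv)).filter_mono (nhdsWithin_le_nhds (s := {v}ᶜ))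
    obtain ⟨z, ⟨hz, hzB⟩, hzv⟩ := (h2.and self_mem_nhdsWithin).exists
    exact hzv (hinj hzB hv (sub_eq_zero.1 hz))
  obtain ⟨n, g, hg, hg0, hfg⟩ := han.exists_eventuallyEq_pow_smul_nonzero_iff.2 hne
  have hn0 : n ≠ 0 := by
    rintro rfl
    have := hfg.self_of_nhds
    simp at this
    exact hg0 this.symm
  rcases eq_or_ne n 1 with rfl | hn1
  · have hd : HasDerivAt (fun z => (z - v) ^ 1 • g z) (g v) v := by
      have h1 := ((hasDerivAt_id v).sub_const v).fun_mul hg.differentiableAt.hasDerivAt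
      simpa using h1
    have h2 : HasDerivAt (fun z => f z - f v) (g v) v := hd.congr_of_eventuallyEq hfg
    have h3 : HasDerivAt f (g v) v := by simpa using h2.add_const (f v)
    rwa [h3.deriv]
  exfalso
  have hgev : ∀ᶠ z in nhds v, g z ≠ 0 := hg.continuousAt.eventually_ne hg0
  obtain ⟨r, hr, hball⟩ := Metric.eventually_nhds_iff_ball.1
    (((hgev.and hg.eventually_analyticAt).and hfg).and (hB.mem_nhds hv))
  obtain ⟨L, hL, hexp⟩ := exists_log_on_ball
    (fun z hz => (hball z hz).1.1.2.differentiableAt.differentiableWithinAt)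
    (fun z hz => (hball z hz).1.1.1)
  have hnC : (n : ℂ) ≠ 0 := Nat.cast_ne_zero.2 hn0
  set φ : ℂ → ℂ := fun z => (z - v) * Complex.exp (L z / n) with hφ
  have hφn : ∀ z ∈ ball v r, φ z ^ n = f z - f v := by
    intro z hz
    rw [(hball z hz).1.2, hφ]
    simp only [mul_pow, ← Complex.exp_nat_mul, smul_eq_mul]
    rw [mul_div_cancel₀ _ hnC, hexp z hz]
  have hvr : v ∈ ball v r := mem_ball_self hr
  have hLd : DifferentiableOn ℂ L (ball v r) :=
    fun z hz => (hL z hz).differentiableAt.differentiableWithinAt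
  have hφd : HasDerivAt φ (Complex.exp (L v / n)) v := by
    have h1 := ((hasDerivAt_id v).sub_const v).fun_mul ((hL v hvr).div_const (n : ℂ)).cexp
    simpa using h1
  have hφan : AnalyticAt ℂ φ v := by
    have h1 : AnalyticAt ℂ L v := hLd.analyticAt (isOpen_ball.mem_nhds hvr)
    fun_prop (disch := assumption)
  have hmap := HasStrictDerivAt.map_nhds_eq
    (hφan.hasStrictDerivAt) (by rw [hφd.deriv]; exact Complex.exp_ne_zero _)
  have hφv : φ v = 0 := by simp [hφ]
  have himg : φ '' ball v r ∈ nhds (0 : ℂ) := by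
    rw [← hφv, ← hmap]; exact image_mem_map (ball_mem_nhds v hr)
  obtain ⟨δ, hδ, hsub⟩ := Metric.mem_nhds_iff.1 himg
  have hζ := Complex.isPrimitiveRoot_exp n hn0
  set ζ := Complex.exp (2 * Real.pi * Complex.I / n)
  have hζ1 : ζ ≠ 1 := hζ.ne_one (by omega)
  obtain ⟨x, hx, hxe⟩ := hsub (show ((δ / 2 : ℝ) : ℂ) ∈ ball 0 δ by
    rw [mem_ball_zero_iff, Complex.norm_real, Real.norm_of_nonneg (by linarith)]; linarith)
  obtain ⟨y, hy, hye⟩ := hsub (show ζ * ((δ / 2 : ℝ) : ℂ) ∈ ball 0 δ by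
    rw [mem_ball_zero_iff, norm_mul, hζ.norm'_eq_one hn0, Complex.norm_real,
      Real.norm_of_nonneg (by linarith)]; linarith)
  have hxy : x = y := by
    refine hinj (hball x hx).2 (hball y hy).2 ?_
    have h1 := hφn x hx
    have h2 := hφn y hy
    rw [hye, mul_pow, hζ.pow_eq_one, one_mul, ← hxe, h1] at h2
    linear_combination h2
  rw [← hxy, hxe] at hye
  have hδ0 : ((δ / 2 : ℝ) : ℂ) ≠ 0 := by exact_mod_cast (by linarith : δ / 2 ≠ 0)
  exact hζ1 (mul_right_cancel₀ hδ0 (by rw [one_mul]; exact hye.symm))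

section Distortion

variable {f : ℂ → ℂ} {B : Set ℂ} {v : ℂ}

lemma dslope_ne_zero_of_injOn (hB : IsOpen B) (hf : DifferentiableOn ℂ f B) (hinj : InjOn f B)
    (hv : v ∈ B) {z : ℂ} (hz : z ∈ B) : dslope f v z ≠ 0 := by
  rcases eq_or_ne z v with rfl | hne
  · rw [dslope_same]; exact deriv_ne_zero_of_injOn hB hf hinj hv
  · intro h
    have := sub_smul_dslope f v z
    rw [h, smul_zero] at this
    exact hne (hinj hz hv (sub_eq_zero.1 this.symm))

lemma norm_logDeriv_dslope_le_of_notMem_ball (hf : DifferentiableOn ℂ f B)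
    (hinj : InjOn f B) (hv : v ∈ B) {z : ℂ} {ρ : ℝ} (hρ : 0 < ρ)
    (hzB : ball z ρ ⊆ B) (hvz : v ∉ ball z ρ) :
    ‖deriv (dslope f v) z / dslope f v z‖ ≤ 401 / ρ := by
  have hzz : z ∈ ball z ρ := mem_ball_self hρ
  have hzv : z ≠ v := fun h => hvz (h ▸ hzz)
  have hfd : DifferentiableOn ℂ (fun w => f w - f v) (ball z ρ) := (hf.mono hzB).sub_const _
  have hsub : ∀ w ∈ ball z ρ, f w - f v ≠ 0 := fun w hw h =>
    hvz ((hinj (hzB hw) hv (sub_eq_zero.1 h)) ▸ hw)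
  have h1 := norm_deriv_mul_le_of_injOn_of_ne_zero hρ hfd
    (fun x hx y hy hxy => hinj (hzB hx) (hzB hy) (sub_left_injective hxy)) hsub
  have hfz : HasDerivAt f (deriv f z) z :=
    ((hf.mono hzB).differentiableAt (isOpen_ball.mem_nhds hzz)).hasDerivAt
  rw [(hfz.sub_const (f v)).deriv] at h1
  have hd0 : z - v ≠ 0 := sub_ne_zero.2 hzv
  have hs0 := hsub z hzz
  have hev : dslope f v =ᶠ[nhds z] fun w => (f w - f v) / (w - v) := by
    filter_upwards [isOpen_ne.mem_nhds hzv] with w hw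
    rw [dslope_of_ne _ hw, slope_def_field]
  have hder : deriv (dslope f v) z / dslope f v z = deriv f z / (f z - f v) - 1 / (z - v) := by
    rw [hev.deriv_eq, hev.eq_of_nhds,
      ((hfz.sub_const (f v)).fun_div ((hasDerivAt_id' z).sub_const v) hd0).deriv]
    field_simp
  have h2 : ‖1 / (z - v)‖ ≤ 1 / ρ := by
    rw [norm_div, norm_one]
    refine one_div_le_one_div_of_le hρ ?_
    rw [← dist_eq_norm, dist_comm]
    exact not_lt.1 hvz
  have h3 : ‖deriv f z / (f z - f v)‖ ≤ 400 / ρ := (le_div_iff₀ hρ).2 h1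
  calc _ ≤ 400 / ρ + 1 / ρ := by rw [hder]; exact (norm_sub_le _ _).trans (add_le_add h3 h2)
    _ = 401 / ρ := by ring

lemma norm_logDeriv_dslope_le (hB : IsOpen B) (hf : DifferentiableOn ℂ f B) (hinj : InjOn f B)
    (hv : v ∈ B) {z₀ z : ℂ} {R : ℝ} (hR : 0 < R) (hzB : ball z₀ R ⊆ B)
    (hz : z ∈ ball z₀ (R / 4)) :
    ‖deriv (dslope f v) z / dslope f v z‖ ≤ 401 / (R / 4) := by
  have hdR : DifferentiableOn ℂ (dslope f v) B :=
    (Complex.differentiableOn_dslope (hB.mem_nhds hv)).2 hf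
  by_cases hvz : R / 2 ≤ dist v z₀
  · refine norm_logDeriv_dslope_le_of_notMem_ball hf hinj hv (by linarith) ?_ ?_
    · refine (ball_subset_ball' ?_).trans hzB
      have := mem_ball.1 hz
      linarith
    · intro h
      have h1 := mem_ball.1 h
      have h2 := mem_ball.1 hz
      have := dist_triangle v z z₀
      linarith
  · push Not at hvz
    have hcl : closure (ball z₀ (3 * R / 4)) ⊆ B :=
      closure_ball_subset_closedBall.trans
        ((closedBall_subset_ball (by linarith)).trans hzB)
    refine Complex.norm_le_of_forall_mem_frontier_norm_le
      (f := fun z => deriv (dslope f v) z / dslope f v z) (U := ball z₀ (3 * R / 4))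
      isBounded_ball ?_ ?_ (subset_closure (ball_subset_ball (by linarith) hz))
    · exact (((hdR.deriv hB).fun_div hdR fun w hw =>
        dslope_ne_zero_of_injOn hB hf hinj hv hw).mono hcl).diffContOnCl
    · intro w hw
      rw [frontier_ball _ (by linarith), mem_sphere] at hw
      refine norm_logDeriv_dslope_le_of_notMem_ball hf hinj hv (by linarith) ?_ ?_
      · exact (ball_subset_ball' (by linarith)).trans hzB
      · intro h
        have h1 := mem_ball'.1 h
        have := dist_triangle w v z₀
        linarith

/-- Harnack-type inequality for difference quotients of univalent functions. -/
lemma norm_dslope_le_exp_mul (hB : IsOpen B) (hf : DifferentiableOn ℂ f B) (hinj : InjOn f B)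
    (hv : v ∈ B) {z₀ z w : ℂ} {R : ℝ} (hR : 0 < R) (hzB : ball z₀ R ⊆ B)
    (hz : z ∈ ball z₀ (R / 4)) (hw : w ∈ ball z₀ (R / 4)) :
    ‖dslope f v z‖ ≤ Real.exp 802 * ‖dslope f v w‖ := by
  have hdR : DifferentiableOn ℂ (dslope f v) B :=
    (Complex.differentiableOn_dslope (hB.mem_nhds hv)).2 hf
  have hsub : ball z₀ (R / 4) ⊆ B := (ball_subset_ball (by linarith)).trans hzB
  obtain ⟨L, hL, hexp⟩ := exists_log_on_ball (hdR.mono hsub)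
    (fun u hu => dslope_ne_zero_of_injOn hB hf hinj hv (hsub hu))
  have h1 := (convex_ball z₀ (R / 4)).norm_image_sub_le_of_norm_hasDerivWithin_le
    (fun u hu => (hL u hu).hasDerivWithinAt)
    (fun u hu => norm_logDeriv_dslope_le hB hf hinj hv hR hzB hu) hw hz
  have h2 : ‖z - w‖ ≤ 2 * (R / 4) := by
    have h3 := mem_ball.1 hz
    have h4 := mem_ball'.1 hw
    have := dist_triangle z z₀ w
    rw [← dist_eq_norm]
    linarith
  have h5 : ‖L z - L w‖ ≤ 802 := by
    refine h1.trans ?_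
    calc 401 / (R / 4) * ‖z - w‖ ≤ 401 / (R / 4) * (2 * (R / 4)) := by gcongr
      _ = 802 := by field_simp; norm_num
  rw [← hexp z hz, ← hexp w hw, Complex.norm_exp, Complex.norm_exp, ← Real.exp_add]
  refine Real.exp_le_exp.2 ?_
  have := (Complex.re_le_norm (L z - L w)).trans h5
  rw [Complex.sub_re] at this
  linarith

end Distortion

/-- Harnack chains: a uniform local comparison on a connected open set yields a uniform comparison
on compact subsets. -/
lemma exists_uniform_comparison {E ι : Type*} [TopologicalSpace E] {B D : Set E}
    (hBc : IsPreconnected B) (hD : IsCompact D) (hDB : D ⊆ B) (F : ι → E → ℝ)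
    (hF : ∀ i x, 0 ≤ F i x)
    (hloc : ∀ x ∈ B, ∃ C : ℝ, ∃ U ∈ nhds x, ∀ i, ∀ y ∈ U, ∀ z ∈ U, F i y ≤ C * F i z) :
    ∃ C : ℝ, 1 ≤ C ∧ ∀ i, ∀ y ∈ D, ∀ z ∈ D, F i y ≤ C * F i z := by
  rcases D.eq_empty_or_nonempty with rfl | ⟨x₀, hx₀⟩
  · exact ⟨1, le_rfl, by simp⟩
  have hloc' : ∀ x ∈ B, ∃ C : ℝ, 0 ≤ C ∧
      ∃ U ∈ nhds x, ∀ i, ∀ y ∈ U, ∀ z ∈ U, F i y ≤ C * F i z := by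
    intro x hx
    obtain ⟨C, U, hU, h⟩ := hloc x hx
    exact ⟨|C|, abs_nonneg _, U, hU, fun i y hy z hz =>
      (h i y hy z hz).trans (mul_le_mul_of_nonneg_right (le_abs_self C) (hF i z))⟩
  have hpair : ∀ x ∈ B, ∀ y ∈ B, ∃ C : ℝ, 0 ≤ C ∧ ∀ i, F i x ≤ C * F i y := by
    intro x hx y hy
    refine hBc.induction₂' (fun x y => ∃ C : ℝ, 0 ≤ C ∧ ∀ i, F i x ≤ C * F i y) ?_ ?_ hx hy
    · intro x hx
      obtain ⟨C, hC, U, hU, h⟩ := hloc' x hx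
      filter_upwards [mem_nhdsWithin_of_mem_nhds hU] with y hy
      exact ⟨⟨C, hC, fun i => h i x (mem_of_mem_nhds hU) y hy⟩,
        ⟨C, hC, fun i => h i y hy x (mem_of_mem_nhds hU)⟩⟩
    · rintro x y z - - - ⟨C, hC, h⟩ ⟨C', hC', h'⟩
      refine ⟨C * C', mul_nonneg hC hC', fun i => (h i).trans ?_⟩
      rw [mul_assoc]
      exact mul_le_mul_of_nonneg_left (h' i) hC
  have hcomp : ∃ C : ℝ, 0 ≤ C ∧ ∀ i, ∀ y ∈ D, F i y ≤ C * F i x₀ ∧ F i x₀ ≤ C * F i y := by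
    refine hD.induction_on
      (p := fun S => ∃ C : ℝ, 0 ≤ C ∧ ∀ i, ∀ y ∈ S, F i y ≤ C * F i x₀ ∧ F i x₀ ≤ C * F i y)
      ⟨0, le_rfl, by simp⟩ ?_ ?_ ?_
    · rintro S T hST ⟨C, hC, h⟩
      exact ⟨C, hC, fun i y hy => h i y (hST hy)⟩
    · rintro S T ⟨C, hC, h⟩ ⟨C', hC', h'⟩
      refine ⟨max C C', le_max_of_le_left hC, fun i y hy => ?_⟩
      rcases hy with hy | hy
      · exact ⟨(h i y hy).1.trans (mul_le_mul_of_nonneg_right (le_max_left _ _) (hF _ _)),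
          (h i y hy).2.trans (mul_le_mul_of_nonneg_right (le_max_left _ _) (hF _ _))⟩
      · exact ⟨(h' i y hy).1.trans (mul_le_mul_of_nonneg_right (le_max_right _ _) (hF _ _)),
          (h' i y hy).2.trans (mul_le_mul_of_nonneg_right (le_max_right _ _) (hF _ _))⟩
    · intro x hx
      obtain ⟨C, hC, U, hU, h⟩ := hloc' x (hDB hx)
      obtain ⟨C₁, hC₁, h₁⟩ := hpair x (hDB hx) x₀ (hDB hx₀)
      obtain ⟨C₂, hC₂, h₂⟩ := hpair x₀ (hDB hx₀) x (hDB hx)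
      refine ⟨U, mem_nhdsWithin_of_mem_nhds hU, max (C * C₁) (C₂ * C),
        le_max_of_le_left (mul_nonneg hC hC₁), fun i y hy => ⟨?_, ?_⟩⟩
      · refine le_trans ?_ (mul_le_mul_of_nonneg_right (le_max_left _ _) (hF _ _))
        rw [mul_assoc]
        exact (h i y hy x (mem_of_mem_nhds hU)).trans (mul_le_mul_of_nonneg_left (h₁ i) hC)
      · refine le_trans ?_ (mul_le_mul_of_nonneg_right (le_max_right _ _) (hF _ _))
        rw [mul_assoc]
        exact (h₂ i).trans (mul_le_mul_of_nonneg_left (h i x (mem_of_mem_nhds hU) y hy) hC₂)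
  obtain ⟨C, hC, h⟩ := hcomp
  refine ⟨max 1 (C * C), le_max_left _ _, fun i y hy z hz => ?_⟩
  refine le_trans ?_ (mul_le_mul_of_nonneg_right (le_max_right _ _) (hF _ _))
  rw [mul_assoc]
  exact (h i y hy).1.trans (mul_le_mul_of_nonneg_left (h i z hz).2 hC)

/-- Koebe distortion: difference quotients of univalent functions on a domain `B` are uniformly
comparable on a compact subset `D`. -/
lemma exists_distortion {D B : Set ℂ} (hD : IsCompact D) (hB : IsOpen B)
    (hBc : IsPreconnected B) (hDB : D ⊆ B) :
    ∃ K : ℝ, 1 ≤ K ∧ ∀ f : ℂ → ℂ, DifferentiableOn ℂ f B → InjOn f B →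
      ∀ z ∈ D, ∀ w ∈ D, ∀ z' ∈ D, ∀ w' ∈ D,
        dist (f z) (f w) * dist z' w' ≤ K * dist (f z') (f w') * dist z w := by
  obtain ⟨C, hC, h⟩ := exists_uniform_comparison hBc hD hDB
    (ι := {p : (ℂ → ℂ) × ℂ // DifferentiableOn ℂ p.1 B ∧ InjOn p.1 B ∧ p.2 ∈ B})
    (fun p z => ‖dslope p.1.1 p.1.2 z‖) (fun _ _ => norm_nonneg _) (by
      intro x hx
      obtain ⟨R, hR, hRB⟩ := Metric.isOpen_iff.1 hB x hx
      exact ⟨Real.exp 802, ball x (R / 4), ball_mem_nhds _ (by linarith),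
        fun p y hy z hz => norm_dslope_le_exp_mul hB p.2.1 p.2.2.1 p.2.2.2 hR hRB hy hz⟩)
  refine ⟨C * C, one_le_mul_of_one_le_of_one_le hC hC, fun f hf hinj z hz w hw z' hz' w' hw' => ?_⟩
  have key : ∀ w ∈ D, ∀ y ∈ D, ∀ z ∈ D, ‖dslope f w y‖ ≤ C * ‖dslope f w z‖ :=
    fun w hw => h ⟨(f, w), hf, hinj, hDB hw⟩
  have hsymm : ∀ a b, dslope f a b = dslope f b a := by
    intro a b
    rcases eq_or_ne a b with rfl | hab
    · rfl
    · rw [dslope_of_ne _ hab, dslope_of_ne _ hab.symm, slope_comm]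
  have hdist : ∀ a b, dist (f a) (f b) = dist a b * ‖dslope f b a‖ := by
    intro a b
    rw [dist_eq_norm, dist_eq_norm, ← sub_smul_dslope, norm_smul]
  have h1 : ‖dslope f w z‖ ≤ C * (C * ‖dslope f w' z'‖) := by
    refine (key w hw z hz z' hz').trans (mul_le_mul_of_nonneg_left ?_ (by linarith))
    rw [hsymm w z', hsymm w' z']
    exact key z' hz' w hw w' hw'
  rw [hdist, hdist]
  have : 0 ≤ dist z w * dist z' w' := by positivity
  nlinarith [mul_le_mul_of_nonneg_left h1 this]

section Words

variable {m : ℕ} {T : Fin m → ℂ → ℂ}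

lemma mapsTo_compWord {S : Set ℂ} (h : ∀ i, MapsTo (T i) S S) :
    ∀ (p : ℕ) (w : Fin p → Fin m), MapsTo (compWord T p w) S S
  | 0, _ => mapsTo_id S
  | p + 1, _ => (h _).comp (mapsTo_compWord h p _)

lemma differentiableOn_compWord {B : Set ℂ} (hm : ∀ i, MapsTo (T i) B B)
    (hd : ∀ i, DifferentiableOn ℂ (T i) B) :
    ∀ (p : ℕ) (w : Fin p → Fin m), DifferentiableOn ℂ (compWord T p w) B
  | 0, _ => differentiableOn_id
  | p + 1, _ => (hd _).comp (differentiableOn_compWord hm hd p _) (mapsTo_compWord hm p _)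

lemma injOn_compWord {B : Set ℂ} (hm : ∀ i, MapsTo (T i) B B) (hi : ∀ i, InjOn (T i) B) :
    ∀ (p : ℕ) (w : Fin p → Fin m), InjOn (compWord T p w) B
  | 0, _ => injOn_id B
  | p + 1, _ => (hi _).comp (injOn_compWord hm hi p _) (mapsTo_compWord hm p _)

lemma dist_compWord_le {D : Set ℂ} {c : ℝ} (hc : 0 ≤ c) (hm : ∀ i, MapsTo (T i) D D)
    (hT : ∀ i, ∀ z ∈ D, ∀ w ∈ D, dist (T i z) (T i w) ≤ c * dist z w) :
    ∀ (p : ℕ) (w : Fin p → Fin m), ∀ z ∈ D, ∀ v ∈ D,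
      dist (compWord T p w z) (compWord T p w v) ≤ c ^ p * dist z v
  | 0, _, z, _, v, _ => by simp [compWord]
  | p + 1, w, z, hz, v, hv => by
    refine (hT _ _ (mapsTo_compWord hm p _ hz) _ (mapsTo_compWord hm p _ hv)).trans ?_
    rw [pow_succ', mul_assoc]
    exact mul_le_mul_of_nonneg_left (dist_compWord_le hc hm hT p _ z hz v hv) hc

lemma subset_iUnion_image_compWord {X : Set ℂ} (h : X = ⋃ i, T i '' X) :
    ∀ p : ℕ, X ⊆ ⋃ w : Fin p → Fin m, compWord T p w '' X
  | 0 => fun x hx => mem_iUnion.2 ⟨Fin.elim0, x, hx, rfl⟩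
  | p + 1 => fun x hx => by
    rw [h] at hx
    obtain ⟨i, y, hy, rfl⟩ := mem_iUnion.1 hx
    obtain ⟨w, u, hu, rfl⟩ := mem_iUnion.1 (subset_iUnion_image_compWord h p hy)
    exact mem_iUnion.2 ⟨Fin.snoc w i, u, hu, by simp [compWord]⟩

end Words

/-- Covers of arbitrarily small mesh whose `s`-sums stay bounded bound the dimension by `s`. -/
lemma dimH_le_of_frequently_sum_rpow_le {E : Type*} [MetricSpace E] {X : Set E} {s : ℝ}
    (hs : 0 < s) {ι : ℕ → Type*} [∀ n, Fintype (ι n)] (t : ∀ n, ι n → Set E)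
    (hcover : ∀ n, X ⊆ ⋃ i, t n i) (r : ℕ → ℝ) (hr : Tendsto r atTop (nhds 0))
    (ht : ∀ n i, ediam (t n i) ≤ ENNReal.ofReal (r n)) (a : ∀ n, ι n → ℝ)
    (ha : ∀ n i, 0 ≤ a n i) (hta : ∀ n i, ediam (t n i) ≤ ENNReal.ofReal (a n i)) (C : ℝ)
    (hC : ∃ᶠ n in atTop, ∑ i, a n i ^ s ≤ C) : dimH X ≤ ENNReal.ofReal s := by
  borelize E
  have hle := Measure.hausdorffMeasure_le_liminf_sum s X (l := atTop)
    (fun n => ENNReal.ofReal (r n)) (by simpa using ENNReal.tendsto_ofReal hr) t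
    (Eventually.of_forall ht) (Eventually.of_forall hcover)
  have hlim : liminf (fun n => ∑ i, ediam (t n i) ^ s) atTop ≤ ENNReal.ofReal C := by
    refine liminf_le_of_frequently_le' (hC.mono fun n hn => ?_)
    calc ∑ i, ediam (t n i) ^ s ≤ ∑ i, ENNReal.ofReal (a n i ^ s) := by
          refine Finset.sum_le_sum fun i _ => ?_
          rw [← ENNReal.ofReal_rpow_of_nonneg (ha n i) hs.le]
          exact ENNReal.rpow_le_rpow (hta n i) hs.le
      _ = ENNReal.ofReal (∑ i, a n i ^ s) :=
          (ENNReal.ofReal_sum_of_nonneg fun i _ => Real.rpow_nonneg (ha n i) s).symm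
      _ ≤ ENNReal.ofReal C := ENNReal.ofReal_le_ofReal hn
  refine dimH_le_of_hausdorffMeasure_ne_top (d := s.toNNReal) ?_
  rw [Real.coe_toNNReal s hs.le]
  exact ((hle.trans hlim).trans_lt ENNReal.ofReal_lt_top).ne

/-- If contractions `T_i` on a compact set `D` extend to conformal self-maps of a domain
`B ⊇ D` and the limit set `X` has Hausdorff dimension `> s`, then for all large `p` the
`p`-fold compositions admit expansion constants `b_i ∈ (0,1)` with `Σ b_i^s > 1`. -/
theorem stmt8 (m : ℕ) (D B : Set ℂ) (hD : IsCompact D) (hB : IsOpen B)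
    (hBconn : IsConnected B) (hDB : D ⊆ B)
    (T : Fin m → ℂ → ℂ)
    (hmaps : ∀ i, Set.MapsTo (T i) D D)
    (hcontr : ∀ i, ∃ c ∈ Set.Ioo (0:ℝ) 1, ∀ z ∈ D, ∀ w ∈ D,
      dist (T i z) (T i w) ≤ c * dist z w)
    (hhol : ∀ i, DifferentiableOn ℂ (T i) B)
    (hinj : ∀ i, Set.InjOn (T i) B)
    (hmapsB : ∀ i, Set.MapsTo (T i) B B)
    (X : Set ℂ) (hXne : X.Nonempty) (hXc : IsCompact X) (hXD : X ⊆ D)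
    (hXinv : X = ⋃ i, T i '' X)
    (s : ℝ) (hs : 0 < s) (hdim : ENNReal.ofReal s < dimH X) :
    ∃ p₀ : ℕ, ∀ p ≥ p₀, ∃ b : (Fin p → Fin m) → ℝ,
      (∀ w, b w ∈ Set.Ioo (0:ℝ) 1) ∧
      (∀ w, ∀ z ∈ D, ∀ v ∈ D,
        b w * dist z v ≤ dist (compWord T p w z) (compWord T p w v)) ∧
      1 < ∑ w : Fin p → Fin m, b w ^ s := by
  classical
  choose c hc hcT using hcontr
  obtain ⟨k, hk0, hk1, hkT⟩ : ∃ k : ℝ, 0 ≤ k ∧ k < 1 ∧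
      ∀ i, ∀ z ∈ D, ∀ w ∈ D, dist (T i z) (T i w) ≤ k * dist z w := by
    obtain ⟨x, hx⟩ := hXne
    rw [hXinv] at hx
    obtain ⟨i₀, -⟩ := mem_iUnion.1 hx
    have hne : (Finset.univ : Finset (Fin m)).Nonempty := ⟨i₀, Finset.mem_univ _⟩
    refine ⟨Finset.univ.sup' hne c, ?_, ?_, fun i z hz w hw => ?_⟩
    · exact (hc i₀).1.le.trans (Finset.le_sup' c (Finset.mem_univ i₀))
    · exact (Finset.sup'_lt_iff hne).2 fun i _ => (hc i).2
    · exact (hcT i z hz w hw).trans (mul_le_mul_of_nonneg_right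
        (Finset.le_sup' c (Finset.mem_univ i)) dist_nonneg)
  obtain ⟨K₀, hK₀, hdist₀⟩ := exists_distortion hD hB hBconn.isPreconnected hDB
  obtain ⟨K, hK, hKdist⟩ : ∃ K : ℝ, 2 ≤ K ∧ ∀ (p : ℕ) (w : Fin p → Fin m),
      ∀ z ∈ D, ∀ v ∈ D, ∀ z' ∈ D, ∀ v' ∈ D,
        dist (compWord T p w z) (compWord T p w v) * dist z' v' ≤
          K * dist (compWord T p w z') (compWord T p w v') * dist z v := by
    refine ⟨K₀ + 1, by linarith, fun p w z hz v hv z' hz' v' hv' => ?_⟩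
    refine (hdist₀ _ (differentiableOn_compWord hmapsB hhol p w)
      (injOn_compWord hmapsB hinj p w) z hz v hv z' hz' v' hv').trans ?_
    gcongr
    linarith
  obtain ⟨x, hx, y, hy, hxy⟩ : X.Nontrivial := by
    rw [← not_subsingleton_iff]
    intro h
    rw [dimH_subsingleton h] at hdim
    exact not_lt_zero hdim
  have hδ : 0 < dist x y := dist_pos.2 hxy
  set lam : ∀ p : ℕ, (Fin p → Fin m) → ℝ := fun p w =>
    dist (compWord T p w x) (compWord T p w y) / dist x y with hlam
  have hlam0 : ∀ p w, 0 < lam p w := fun p w => div_pos (dist_pos.2 fun h =>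
    hxy (injOn_compWord hmapsB hinj p w (hDB (hXD hx)) (hDB (hXD hy)) h)) hδ
  have hlam1 : ∀ p w, lam p w ≤ 1 := fun p w => by
    rw [hlam, div_le_one hδ]
    refine (dist_compWord_le hk0 hmaps hkT p w x (hXD hx) y (hXD hy)).trans ?_
    exact mul_le_of_le_one_left hδ.le (pow_le_one₀ hk0 hk1.le)
  have hlower : ∀ p w, ∀ z ∈ D, ∀ v ∈ D,
      lam p w / K * dist z v ≤ dist (compWord T p w z) (compWord T p w v) := by
    intro p w z hz v hv
    have h1 := hKdist p w x (hXD hx) y (hXD hy) z hz v hv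
    rw [hlam, div_div, div_mul_eq_mul_div, div_le_iff₀ (by positivity)]
    linarith
  have hupper : ∀ p w, ∀ z ∈ D, ∀ v ∈ D,
      dist (compWord T p w z) (compWord T p w v) ≤ K * lam p w * dist z v := by
    intro p w z hz v hv
    have h1 := hKdist p w z hz v hv x (hXD hx) y (hXD hy)
    rw [hlam, mul_div_assoc', div_mul_eq_mul_div, le_div_iff₀ hδ]
    exact h1
  obtain ⟨Δ, hΔ0, hΔ⟩ : ∃ Δ : ℝ, 0 ≤ Δ ∧ ∀ z ∈ X, ∀ v ∈ X, dist z v ≤ Δ :=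
    ⟨diam X, diam_nonneg, fun z hz v hv => dist_le_diam_of_mem hXc.isBounded hz hv⟩
  have hediam : ∀ (p : ℕ) (w : Fin p → Fin m) (q : ℝ), 0 ≤ q → (∀ z ∈ D, ∀ v ∈ D,
      dist (compWord T p w z) (compWord T p w v) ≤ q * dist z v) →
      ediam (compWord T p w '' X) ≤ ENNReal.ofReal (q * Δ) := by
    intro p w q hq h
    refine ediam_le ?_
    rintro _ ⟨z, hz, rfl⟩ _ ⟨v, hv, rfl⟩
    rw [edist_dist]
    exact ENNReal.ofReal_le_ofReal ((h z (hXD hz) v (hXD hv)).trans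
      (mul_le_mul_of_nonneg_left (hΔ z hz v hv) hq))
  have hev : ∀ᶠ p in atTop, 1 < ∑ w : Fin p → Fin m, (lam p w / K) ^ s := by
    by_contra hcon
    rw [not_eventually] at hcon
    refine hdim.not_ge (dimH_le_of_frequently_sum_rpow_le hs
      (fun p (w : Fin p → Fin m) => compWord T p w '' X) (subset_iUnion_image_compWord hXinv)
      (fun p => k ^ p * Δ)
      (by simpa using (tendsto_pow_atTop_nhds_zero_of_lt_one hk0 hk1).mul_const Δ)
      (fun p w => hediam p w _ (pow_nonneg hk0 p) (dist_compWord_le hk0 hmaps hkT p w))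
      (fun p w => K * lam p w * Δ) (fun p w => by have := hlam0 p w; positivity)
      (fun p w => hediam p w _ (by have := hlam0 p w; positivity) (hupper p w))
      ((K * K * Δ) ^ s) (hcon.mono fun p hp => ?_))
    have : ∀ w, (K * lam p w * Δ) ^ s = (K * K * Δ) ^ s * (lam p w / K) ^ s := fun w => by
      have := hlam0 p w
      rw [← Real.mul_rpow (by positivity) (by positivity)]
      congr 1
      field_simp
    simp only [this, ← Finset.mul_sum]
    exact mul_le_of_le_one_right (by positivity) (not_lt.1 hp)
  obtain ⟨p₀, hp₀⟩ := eventually_atTop.1 hev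
  refine ⟨p₀, fun p hp => ⟨fun w => lam p w / K, fun w => ⟨?_, ?_⟩, hlower p, hp₀ p hp⟩⟩
  · have := hlam0 p w
    positivity
  · rw [div_lt_one (by positivity)]
    linarith [hlam1 p w]
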